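/- arXiv:2403.17506 — 2 statements merged into one kernel-verified Lean document; each statement's English description precedes it below -/
import Mathlib

section
/- Let p̄ > 0, ε > 0, c₀ > ε, and for each δ > 0 set c = δ + c₀. Fix s ∈ ℝ. Then the map δ ↦ B_{δ,δ+c₀,ε}(s) is differentiable at every δ lying in the interior of each of the five regions, with derivative: 0 if δ > s; (p̄/(2c₀))·(3(s−δ)²/ε² − 4(s−δ)/ε) if s − ε < δ < s; −p̄/(2c₀) if s + ε − 2c₀ < δ < s − ε; −(p̄/(2c₀))·(4(2c₀ − s + δ)/ε − 3(2c₀ − s + δ)²/ε²) if s − 2c₀ < δ < s + ε − 2c₀; and 0 if δ < s − 2c₀. -/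
/-- The binarization function `B_{δ,c,ε} : ℝ → ℝ`. -/
noncomputable def binarization (pbar δ c ε s : ℝ) : ℝ :=
  if s ≤ δ then 0
  else if s < δ + ε then (2 - (s - δ) / ε) * ((s - δ) ^ 2 / ε) * (pbar / (2 * (c - δ)))
  else if s ≤ 2 * c - δ - ε then pbar * (s - δ) / (2 * (c - δ))
  else if s < 2 * c - δ then
    pbar - (2 - (2 * (c - δ) - s + δ) / ε) * ((2 * (c - δ) - s + δ) ^ 2 / ε) *
      (pbar / (2 * (c - δ)))
  else pbar

/-- For `p̄ > 0`, `ε > 0`, `c₀ > ε` and `c = δ + c₀`, fixing `s ∈ ℝ`, the map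
`δ ↦ B_{δ,δ+c₀,ε}(s)` is differentiable at every `δ > 0` lying in the interior of
each of the five regions, with the stated piecewise derivative. -/
theorem binarization_hasDerivAt_wrt_delta (pbar ε c₀ : ℝ)
    (hp : 0 < pbar) (hε : 0 < ε) (hc : ε < c₀) (s : ℝ) :
    (∀ δ : ℝ, 0 < δ → s < δ →
      HasDerivAt (fun d => binarization pbar d (d + c₀) ε s) 0 δ) ∧
    (∀ δ : ℝ, 0 < δ → s - ε < δ → δ < s →
      HasDerivAt (fun d => binarization pbar d (d + c₀) ε s)
        ((pbar / (2 * c₀)) * (3 * (s - δ) ^ 2 / ε ^ 2 - 4 * (s - δ) / ε)) δ) ∧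
    (∀ δ : ℝ, 0 < δ → s + ε - 2 * c₀ < δ → δ < s - ε →
      HasDerivAt (fun d => binarization pbar d (d + c₀) ε s)
        (-(pbar / (2 * c₀))) δ) ∧
    (∀ δ : ℝ, 0 < δ → s - 2 * c₀ < δ → δ < s + ε - 2 * c₀ →
      HasDerivAt (fun d => binarization pbar d (d + c₀) ε s)
        (-(pbar / (2 * c₀)) *
          (4 * (2 * c₀ - s + δ) / ε - 3 * (2 * c₀ - s + δ) ^ 2 / ε ^ 2)) δ) ∧
    (∀ δ : ℝ, 0 < δ → δ < s - 2 * c₀ →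
      HasDerivAt (fun d => binarization pbar d (d + c₀) ε s) 0 δ) := by
  have hc0 : c₀ ≠ 0 := by linarith
  have hε0 : ε ≠ 0 := hε.ne'
  have e1 : ∀ d : ℝ, d + c₀ - d = c₀ := fun d => by ring
  refine ⟨?_, ?_, ?_, ?_, ?_⟩
  · intro δ _ h
    refine (hasDerivAt_const δ (0 : ℝ)).congr_of_eventuallyEq ?_
    filter_upwards [Ioi_mem_nhds h] with d hd
    simp only [Set.mem_Ioi] at hd
    simp only [binarization]
    rw [if_pos hd.le]
  · intro δ _ h1 h2
    have hu : HasDerivAt (fun d : ℝ => s - d) (-1) δ := by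
      simpa using (hasDerivAt_id δ).const_sub s
    have key := ((((hu.div_const ε).const_sub 2).mul ((hu.pow 2).div_const ε)).mul_const
      (pbar / (2 * c₀)))
    refine HasDerivAt.congr_of_eventuallyEq (key.congr_deriv ?_) ?_
    · simp
      field_simp
      ring
    · filter_upwards [Ioo_mem_nhds h1 h2] with d hd
      obtain ⟨h3, h4⟩ := hd
      simp only [binarization]
      rw [if_neg (by linarith), if_pos (by linarith), e1]
      simp
  · intro δ _ h1 h2
    have hu : HasDerivAt (fun d : ℝ => s - d) (-1) δ := by
      simpa using (hasDerivAt_id δ).const_sub s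
    have key := (hu.const_mul pbar).div_const (2 * c₀)
    refine HasDerivAt.congr_of_eventuallyEq (key.congr_deriv ?_) ?_
    · ring
    · filter_upwards [Ioo_mem_nhds h1 h2] with d hd
      obtain ⟨h3, h4⟩ := hd
      simp only [binarization]
      rw [if_neg (by linarith), if_neg (by linarith), if_pos (by linarith), e1]
  · intro δ _ h1 h2
    have hu : HasDerivAt (fun d : ℝ => 2 * c₀ - s + d) 1 δ := by
      simpa using (hasDerivAt_id δ).const_add (2 * c₀ - s)
    have key := ((((hu.div_const ε).const_sub 2).mul ((hu.pow 2).div_const ε)).mul_const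
      (pbar / (2 * c₀))).const_sub pbar
    refine HasDerivAt.congr_of_eventuallyEq (key.congr_deriv ?_) ?_
    · simp
      field_simp
      ring
    · filter_upwards [Ioo_mem_nhds h1 h2] with d hd
      obtain ⟨h3, h4⟩ := hd
      simp only [binarization]
      rw [if_neg (by linarith), if_neg (by linarith), if_neg (by linarith),
        if_pos (by linarith), e1]
      simp
  · intro δ _ h
    refine (hasDerivAt_const δ pbar).congr_of_eventuallyEq ?_
    filter_upwards [Iio_mem_nhds h] with d hd
    simp only [Set.mem_Iio] at hd
    simp only [binarization]
    rw [if_neg (by linarith), if_neg (by linarith), if_neg (by linarith),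
      if_neg (by linarith)]
end

section
/- Let a > 0 and s > 0, and set ρ₀ = a²s²/2. Then the function ρ ↦ φ'(s; ρ, a) (where φ'(s; ρ, a) = −a²·(s − √(2ρ)/a) for ρ > ρ₀ and 0 for ρ ≤ ρ₀) is not differentiable at ρ = ρ₀: its left derivative at ρ₀ equals 0 while its right derivative at ρ₀ equals 1/s ≠ 0. -/
/-- For `a > 0`, `s > 0` and `ρ₀ = a²s²/2`, the map `ρ ↦ φ'(s; ρ, a)` (equal to
`−a²(s − √(2ρ)/a)` for `ρ > ρ₀` and `0` for `ρ ≤ ρ₀`) is not differentiable at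
`ρ = ρ₀`: its left derivative there is `0` while its right derivative is
`1/s ≠ 0`. -/
theorem cel0phi_prime_not_differentiable_in_rho (a s : ℝ) (ha : 0 < a) (hs : 0 < s)
    (ρ₀ : ℝ) (hρ₀ : ρ₀ = a ^ 2 * s ^ 2 / 2)
    (φ' : ℝ → ℝ)
    (hφ' : φ' = fun ρ =>
      if a ^ 2 * s ^ 2 / 2 < ρ then -a ^ 2 * (s - Real.sqrt (2 * ρ) / a) else 0) :
    HasDerivWithinAt φ' 0 (Set.Iic ρ₀) ρ₀ ∧
    HasDerivWithinAt φ' (1 / s) (Set.Ici ρ₀) ρ₀ ∧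
    (1 / s ≠ 0) ∧
    ¬ DifferentiableAt ℝ φ' ρ₀ := by
  have hsq : Real.sqrt (2 * ρ₀) = a * s := by
    rw [hρ₀, show 2 * (a ^ 2 * s ^ 2 / 2) = (a * s) ^ 2 by ring]
    exact Real.sqrt_sq (by positivity)
  have hpos : 2 * ρ₀ ≠ 0 := by
    rw [hρ₀]; positivity
  have hL : HasDerivWithinAt φ' 0 (Set.Iic ρ₀) ρ₀ := by
    refine (hasDerivWithinAt_const ρ₀ (Set.Iic ρ₀) (0 : ℝ)).congr_of_mem ?_ Set.self_mem_Iic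
    intro x hx
    have hx' : x ≤ ρ₀ := hx
    rw [hφ']
    exact if_neg (by rw [← hρ₀]; exact not_lt.mpr hx')
  have hR : HasDerivWithinAt φ' (1 / s) (Set.Ici ρ₀) ρ₀ := by
    have h1 : HasDerivAt (fun ρ : ℝ => 2 * ρ) 2 ρ₀ := by
      simpa using (hasDerivAt_id ρ₀).const_mul (2 : ℝ)
    have h2 := (((h1.sqrt hpos).div_const a).const_sub s).const_mul (-a ^ 2)
    have h3 : HasDerivAt (fun ρ : ℝ => -a ^ 2 * (s - Real.sqrt (2 * ρ) / a)) (1 / s) ρ₀ := by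
      refine h2.congr_deriv ?_
      rw [hsq]
      field_simp
    refine h3.hasDerivWithinAt.congr_of_mem ?_ Set.self_mem_Ici
    intro x hx
    have hx' : ρ₀ ≤ x := hx
    rw [hφ']
    rcases hx'.eq_or_lt with h | h
    · subst h
      have : a * s / a = s := by field_simp
      simp only [hsq, this, sub_self, mul_zero, ite_self]
    · exact if_pos (by rw [← hρ₀]; exact h)
  have hne : 1 / s ≠ 0 := by positivity
  refine ⟨hL, hR, hne, fun hd => hne ?_⟩
  have e1 := (uniqueDiffOn_Iic ρ₀ ρ₀ Set.self_mem_Iic).eq_deriv _ hL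
    hd.hasDerivAt.hasDerivWithinAt
  have e2 := (uniqueDiffOn_Ici ρ₀ ρ₀ Set.self_mem_Ici).eq_deriv _ hR
    hd.hasDerivAt.hasDerivWithinAt
  rw [e2, ← e1]
end
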